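/- Let G = ([n], E) be a natural unit interval graph, and for each j ∈ [n] let c_j = |{i < j : {i,j} ∈ E}|. Then for every natural number q, Σ_σ q^{RLmin(σ)} = Π_{j=1}^{n} (q + c_j), where the sum is over all permutations σ of [n] such that every descent of σ is a G-descent, and RLmin(σ) is the number of right-to-left minima of σ. -/

import Mathlib

open Classical

/-- `G` is a natural unit interval graph: for every edge `{i,j}` with `i < j` and every
`i < k < j`, both `{i,k}` and `{k,j}` are edges. -/
def IsNaturalUnitIntervalGraph {n : ℕ} (G : SimpleGraph (Fin n)) : Prop :=
  ∀ i j k : Fin n, G.Adj i j → i < k → k < j → G.Adj i k ∧ G.Adj k j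

/-- Every descent of `σ` is a `G`-descent: whenever `σ_t > σ_{t+1}`,
`{σ_t, σ_{t+1}}` is an edge of `G`. -/
def AllDescentsGDescents {n : ℕ} (G : SimpleGraph (Fin n)) (σ : Equiv.Perm (Fin n)) : Prop :=
  ∀ (t : ℕ) (h : t + 1 < n), σ ⟨t + 1, h⟩ < σ ⟨t, Nat.lt_of_succ_lt h⟩ →
    G.Adj (σ ⟨t, Nat.lt_of_succ_lt h⟩) (σ ⟨t + 1, h⟩)

/-- The permutation of `Fin (n + 1)` whose one-line notation is that of `σ` with the new maximum
inserted at position `p`. -/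
def insertMax {n : ℕ} (p : Fin (n + 1)) (σ : Equiv.Perm (Fin n)) : Equiv.Perm (Fin (n + 1)) :=
  (finSuccEquiv' p).trans ((Equiv.optionCongr σ).trans (finSuccEquiv' (Fin.last n)).symm)

/-- The number of right-to-left minima of `σ`. -/
noncomputable def numRLmin {n : ℕ} (σ : Equiv.Perm (Fin n)) : ℕ :=
  (Finset.univ.filter fun i : Fin n => ∀ j : Fin n, i < j → σ i < σ j).card

@[simp] lemma insertMax_self {n : ℕ} (p : Fin (n + 1)) (σ : Equiv.Perm (Fin n)) :
    insertMax p σ p = Fin.last n := by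
  simp [insertMax]

@[simp] lemma insertMax_succAbove {n : ℕ} (p : Fin (n + 1)) (σ : Equiv.Perm (Fin n)) (i : Fin n) :
    insertMax p σ (p.succAbove i) = (σ i).castSucc := by
  simp [insertMax]

lemma insertMax_of_lt {n : ℕ} (p : Fin (n + 1)) (σ : Equiv.Perm (Fin n)) (j : ℕ) (hj : j < n)
    (h : j < p) : insertMax p σ ⟨j, Nat.lt_succ_of_lt hj⟩ = (σ ⟨j, hj⟩).castSucc := by
  rw [← insertMax_succAbove p, Fin.succAbove_of_castSucc_lt _ _ (by simpa [Fin.lt_def] using h)]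
  rfl

lemma insertMax_of_le {n : ℕ} (p : Fin (n + 1)) (σ : Equiv.Perm (Fin n)) (j : ℕ) (hj : j < n)
    (h : p ≤ j) : insertMax p σ ⟨j + 1, Nat.succ_lt_succ hj⟩ = (σ ⟨j, hj⟩).castSucc := by
  rw [← insertMax_succAbove p, Fin.succAbove_of_le_castSucc _ _ (by simpa [Fin.le_def] using h)]
  rfl

lemma insertMax_of_eq {n : ℕ} (p : Fin (n + 1)) (σ : Equiv.Perm (Fin n)) (j : ℕ) (hj : j < n + 1)
    (h : j = p) : insertMax p σ ⟨j, hj⟩ = Fin.last n := by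
  obtain rfl : p = ⟨j, hj⟩ := Fin.ext h.symm
  simp

lemma insertMax_bijective (n : ℕ) :
    Function.Bijective fun x : Equiv.Perm (Fin n) × Fin (n + 1) => insertMax x.2 x.1 := by
  rw [Fintype.bijective_iff_injective_and_card]
  constructor
  · rintro ⟨σ, p⟩ ⟨τ, r⟩ h
    simp only at h
    obtain rfl : p = r := by
      apply (insertMax p σ).injective
      rw [insertMax_self, h, insertMax_self]
    obtain rfl : σ = τ := by
      ext i
      have := congrArg (fun e : Equiv.Perm (Fin (n + 1)) => (e (p.succAbove i)).val) h
      simpa using this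
    rfl
  · simp [Fintype.card_perm, Nat.factorial_succ, mul_comm]

lemma IsNaturalUnitIntervalGraph.comap_castSucc {n : ℕ} {G : SimpleGraph (Fin (n + 1))}
    (hG : IsNaturalUnitIntervalGraph G) : IsNaturalUnitIntervalGraph (G.comap Fin.castSucc) :=
  fun i j k hij hik hkj => hG i.castSucc j.castSucc k.castSucc hij hik hkj

lemma AllDescentsGDescents.of_insertMax {n : ℕ} {G : SimpleGraph (Fin (n + 1))}
    (hG : IsNaturalUnitIntervalGraph G) {σ : Equiv.Perm (Fin n)} {p : Fin (n + 1)}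
    (h : AllDescentsGDescents G (insertMax p σ)) :
    AllDescentsGDescents (G.comap Fin.castSucc) σ := by
  intro t ht hlt
  rw [SimpleGraph.comap_adj]
  rcases lt_trichotomy (t + 1) p.val with hp | hp | hp
  · have := h t (by omega)
    rw [insertMax_of_lt p σ t (by omega) (by omega), insertMax_of_lt p σ (t + 1) ht hp] at this
    exact this hlt
  · have := h (t + 1) (by omega)
    rw [insertMax_of_eq p σ (t + 1) (by omega) hp,
      insertMax_of_le p σ (t + 1) ht (by omega)] at this
    exact (hG _ _ _ (this (Fin.castSucc_lt_last _)).symm (Fin.castSucc_lt_castSucc_iff.2 hlt)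
      (Fin.castSucc_lt_last _)).1.symm
  · have := h (t + 1) (by omega)
    rw [insertMax_of_le p σ t (by omega) (by omega),
      insertMax_of_le p σ (t + 1) ht (by omega)] at this
    exact this hlt

lemma AllDescentsGDescents.insertMax {n : ℕ} {G : SimpleGraph (Fin (n + 1))}
    {σ : Equiv.Perm (Fin n)} (h : AllDescentsGDescents (G.comap Fin.castSucc) σ) {p : Fin (n + 1)}
    (hp : ∀ i : Fin n, p = i.castSucc → G.Adj (σ i).castSucc (Fin.last n)) :
    AllDescentsGDescents G (insertMax p σ) := by
  intro t ht
  rcases lt_trichotomy (t + 1) p.val with htp | htp | htp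
  · rw [insertMax_of_lt p σ t (by omega) (by omega),
      insertMax_of_lt p σ (t + 1) (by omega) htp]
    exact h t (by omega)
  · rw [insertMax_of_eq p σ (t + 1) (by omega) htp]
    exact fun hlt => absurd hlt (Fin.le_last _).not_gt
  · rw [insertMax_of_le p σ t (by omega) (by omega)]
    rcases (Nat.lt_succ_iff.1 htp).eq_or_lt with hpt | hpt
    · rw [insertMax_of_eq p σ t (by omega) hpt.symm]
      exact fun _ => (hp ⟨t, by omega⟩ (Fin.ext hpt)).symm
    · obtain ⟨t, rfl⟩ : ∃ s, t = s + 1 := ⟨t - 1, by omega⟩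
      rw [insertMax_of_le p σ t (by omega) (by omega)]
      exact h t (by omega)

lemma allDescentsGDescents_insertMax_last_iff {n : ℕ} {G : SimpleGraph (Fin (n + 1))}
    (hG : IsNaturalUnitIntervalGraph G) (σ : Equiv.Perm (Fin n)) :
    AllDescentsGDescents G (insertMax (Fin.last n) σ) ↔
      AllDescentsGDescents (G.comap Fin.castSucc) σ :=
  ⟨fun h => h.of_insertMax hG, fun h => h.insertMax fun i hi => absurd hi.symm i.castSucc_ne_last⟩

lemma allDescentsGDescents_insertMax_castSucc_iff {n : ℕ} {G : SimpleGraph (Fin (n + 1))}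
    (hG : IsNaturalUnitIntervalGraph G) (σ : Equiv.Perm (Fin n)) (i : Fin n) :
    AllDescentsGDescents G (insertMax i.castSucc σ) ↔
      AllDescentsGDescents (G.comap Fin.castSucc) σ ∧ G.Adj (σ i).castSucc (Fin.last n) := by
  refine ⟨fun h => ⟨h.of_insertMax hG, ?_⟩, fun h => h.1.insertMax fun k hk => ?_⟩
  · have := h i.val (by omega)
    rw [insertMax_of_eq _ σ i.val (by omega) rfl, insertMax_of_le _ σ i.val i.2 le_rfl] at this
    exact (this (Fin.castSucc_lt_last _)).symm
  · obtain rfl := Fin.castSucc_injective _ hk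
    exact h.2

lemma numRLmin_insertMax {n : ℕ} (p : Fin (n + 1)) (σ : Equiv.Perm (Fin n)) :
    numRLmin (insertMax p σ) = (if p = Fin.last n then 1 else 0) + numRLmin σ := by
  have hmax : (∀ j, p < j → insertMax p σ p < insertMax p σ j) ↔ p = Fin.last n := by
    constructor
    · intro h
      by_contra hp
      have := h _ (Fin.lt_last_iff_ne_last.2 hp)
      rw [insertMax_self] at this
      exact (Fin.le_last _).not_gt this
    · rintro rfl j hj
      exact absurd hj (Fin.le_last _).not_gt
  unfold numRLmin
  rw [Finset.card_filter, Finset.card_filter, Fin.sum_univ_succAbove _ p]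
  simp only [hmax]
  congr 1
  refine Finset.sum_congr rfl fun i _ => ?_
  simp [Fin.forall_iff_succAbove p, Fin.succAbove_lt_succAbove_iff]

lemma sum_pow_numRLmin_succ {n : ℕ} {G : SimpleGraph (Fin (n + 1))}
    (hG : IsNaturalUnitIntervalGraph G) (q : ℕ) :
    ∑ σ : Equiv.Perm (Fin (n + 1)), (if AllDescentsGDescents G σ then q ^ numRLmin σ else 0) =
      (∑ σ : Equiv.Perm (Fin n),
        if AllDescentsGDescents (G.comap Fin.castSucc) σ then q ^ numRLmin σ else 0) *
      (q + (Finset.univ.filter fun i : Fin n => G.Adj i.castSucc (Fin.last n)).card) := by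
  rw [← (insertMax_bijective n).sum_comp, Fintype.sum_prod_type, Finset.sum_mul]
  refine Finset.sum_congr rfl fun σ _ => ?_
  simp only [Fin.sum_univ_castSucc, allDescentsGDescents_insertMax_last_iff hG,
    allDescentsGDescents_insertMax_castSucc_iff hG, numRLmin_insertMax, Fin.castSucc_ne_last]
  by_cases h : AllDescentsGDescents (G.comap Fin.castSucc) σ
  · have hc : ∑ i, (if G.Adj (σ i).castSucc (Fin.last n) then q ^ numRLmin σ else 0) =
        (Finset.univ.filter fun i : Fin n => G.Adj i.castSucc (Fin.last n)).card *
          q ^ numRLmin σ := by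
      rw [Equiv.sum_comp σ fun i =>
        if G.Adj i.castSucc (Fin.last n) then q ^ numRLmin σ else 0, ← Finset.sum_filter]
      simp
    simp only [h, true_and, if_true, if_false, zero_add, hc]
    ring
  · simp [h]

/-- for a natural unit interval graph `G` with `c_j = #{i < j : {i,j} ∈ E}`,
`∑_σ q^{RLmin(σ)} = ∏_{j=1}^n (q + c_j)`, the sum being over permutations of `[n]` all of
whose descents are `G`-descents. -/
theorem sum_RLmin_over_G_local_minima {n : ℕ} (G : SimpleGraph (Fin n))
    (hG : IsNaturalUnitIntervalGraph G) (q : ℕ) :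
    ∑ σ ∈ Finset.univ.filter (fun σ : Equiv.Perm (Fin n) => AllDescentsGDescents G σ),
        q ^ (Finset.univ.filter fun i : Fin n => ∀ j : Fin n, i < j → σ i < σ j).card =
      ∏ j : Fin n, (q + (Finset.univ.filter fun i : Fin n => i < j ∧ G.Adj i j).card) := by
  rw [Finset.sum_filter]
  change ∑ σ, (if AllDescentsGDescents G σ then q ^ numRLmin σ else 0) = _
  induction n with
  | zero =>
    have h (σ : Equiv.Perm (Fin 0)) : AllDescentsGDescents G σ := fun t ht => absurd ht (by omega)
    simp [h, numRLmin]
  | succ n ih =>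
    rw [sum_pow_numRLmin_succ hG, ih _ hG.comap_castSucc, Fin.prod_univ_castSucc]
    simp only [Finset.card_filter, Fin.sum_univ_castSucc]
    simp [Fin.castSucc_lt_last, (Fin.castSucc_lt_last _).not_gt]
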